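/- arXiv:2512.19344 — 6 statements merged into one kernel-verified Lean document; each statement's English description precedes it below -/
import Mathlib

section
/- Let n ≥ 1. The set Δ_Sp = {α₁,…,αₙ} is a base (set of simple roots) of the root system Φ(Cₙ): each αₖ belongs to Φ(Cₙ), the vectors α₁,…,αₙ are linearly independent over ℚ, and every root β ∈ Φ(Cₙ) can be written as β = Σₖ cₖ αₖ with integer coefficients cₖ that are either all nonnegative or all nonpositive. Moreover, no element of Δ_Sp is of the form ±(eᵢ − eⱼ) with i ≠ j; i.e., every element of Δ_Sp is a non-compact root of sp(2n,ℝ) relative to its compact Cartan subalgebra. -/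
/-- The `i`-th standard basis vector of `ℚⁿ` (`0`-based index `i`). -/
def stdE (n i : ℕ) : Fin n → ℚ := fun j => if (j : ℕ) = i then 1 else 0

/-- The root system of type `Cₙ`:
`Φ(Cₙ) = {±eᵢ ± eⱼ : 1 ≤ i < j ≤ n} ∪ {±2eᵢ : 1 ≤ i ≤ n}` (written `0`-based). -/
def PhiC (n : ℕ) : Set (Fin n → ℚ) :=
  {v | (∃ i j : ℕ, i < j ∧ j < n ∧ ∃ ε δ : ℚ, (ε = 1 ∨ ε = -1) ∧ (δ = 1 ∨ δ = -1) ∧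
          v = ε • stdE n i + δ • stdE n j) ∨
       (∃ i : ℕ, i < n ∧ ∃ ε : ℚ, (ε = 1 ∨ ε = -1) ∧ v = ε • ((2 : ℚ) • stdE n i))}

/-- The simple roots `Δ_Sp = {α₁, …, αₙ}`, indexed `0`-based by `k` (so `αₖ₊₁ = alphaSp n k`):
`α_{2m−1} = e_m + e_{n+1−m}` and `α_{2m} = −e_{n+1−m} − e_{m+1}` (`1`-based). -/
def alphaSp (n k : ℕ) : Fin n → ℚ :=
  if k % 2 = 0 then stdE n (k / 2) + stdE n (n - 1 - k / 2)
  else -stdE n (n - (k + 1) / 2) - stdE n ((k + 1) / 2)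

/-- The sequence `e_1, -e_n, e_2, -e_{n-1}, …` whose consecutive differences are the `αₖ`. -/
def fSp (n k : ℕ) : Fin n → ℚ :=
  if k % 2 = 0 then stdE n (k / 2) else -stdE n (n - 1 - k / 2)

theorem alphaSp_eq (n k : ℕ) : alphaSp n k = fSp n k - fSp n (k + 1) := by
  unfold alphaSp fSp
  rcases Nat.even_or_odd' k with ⟨m, rfl | rfl⟩
  · rw [if_pos (by omega), if_pos (by omega), if_neg (by omega)]
    rw [show (2 * m + 1) / 2 = 2 * m / 2 by omega]
    abel
  · rw [if_neg (by omega), if_neg (by omega), if_pos (by omega)]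
    rw [show n - 1 - (2 * m + 1) / 2 = n - (2 * m + 1 + 1) / 2 by omega]

theorem fSp_refl (n k : ℕ) (hk : k < 2 * n) : fSp n (2 * n - 1 - k) = -fSp n k := by
  unfold fSp
  rcases Nat.even_or_odd' k with ⟨m, rfl | rfl⟩
  · rw [if_neg (by omega), if_pos (by omega)]
    rw [show n - 1 - (2 * n - 1 - 2 * m) / 2 = 2 * m / 2 by omega]
  · rw [if_pos (by omega), if_neg (by omega), neg_neg]
    congr 1
    omega

/-- The nonnegative integer cone spanned by the `αₖ`. -/
def PosSp (n : ℕ) (v : Fin n → ℚ) : Prop :=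
  ∃ c : Fin n → ℤ, v = ∑ k : Fin n, (c k : ℚ) • alphaSp n (k : ℕ) ∧ ∀ k, 0 ≤ c k

theorem PosSp.addSp {n : ℕ} {v w : Fin n → ℚ} (hv : PosSp n v) (hw : PosSp n w) :
    PosSp n (v + w) := by
  obtain ⟨c, rfl, hc⟩ := hv
  obtain ⟨d, rfl, hd⟩ := hw
  refine ⟨fun k => c k + d k, ?_, fun k => Int.add_nonneg (hc k) (hd k)⟩
  simp only [Int.cast_add, add_smul, Finset.sum_add_distrib]

theorem posSp_alpha {n k : ℕ} (hk : k < n) : PosSp n (alphaSp n k) := by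
  refine ⟨fun j => if j = ⟨k, hk⟩ then 1 else 0, ?_, fun j => by dsimp only; split_ifs <;> simp⟩
  simp [ite_smul]

theorem posSp_step {n k : ℕ} (hk : k + 1 < 2 * n) : PosSp n (fSp n k - fSp n (k + 1)) := by
  by_cases h : k < n
  · rw [← alphaSp_eq]; exact posSp_alpha h
  · have h1 := fSp_refl n k (by omega)
    have h2 := fSp_refl n (k + 1) hk
    have h3 := alphaSp_eq n (2 * n - 1 - (k + 1))
    rw [show 2 * n - 1 - (k + 1) + 1 = 2 * n - 1 - k by omega, h1, h2] at h3
    rw [show fSp n k - fSp n (k + 1) = -fSp n (k + 1) - -fSp n k by abel, ← h3]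
    exact posSp_alpha (by omega)

theorem posSp_diff {n a b : ℕ} (hab : a ≤ b) (hb : b < 2 * n) :
    PosSp n (fSp n a - fSp n b) := by
  induction b, hab using Nat.le_induction with
  | base => exact ⟨fun _ => 0, by simp, fun _ => le_rfl⟩
  | succ b h ih =>
    have := (ih (by omega)).addSp (posSp_step hb)
    rwa [sub_add_sub_cancel] at this

theorem exists_fSp {n i : ℕ} (hi : i < n) {ε : ℚ} (hε : ε = 1 ∨ ε = -1) :
    ∃ a < 2 * n, fSp n a = ε • stdE n i := by
  have key : fSp n (2 * i) = stdE n i := by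
    unfold fSp
    rw [if_pos (by omega)]
    congr 1; omega
  rcases hε with rfl | rfl
  · exact ⟨2 * i, by omega, by rw [key, one_smul]⟩
  · exact ⟨2 * n - 1 - 2 * i, by omega, by rw [fSp_refl _ _ (by omega), key, neg_one_smul]⟩

theorem phiC_diff {n : ℕ} {v : Fin n → ℚ} (hv : v ∈ PhiC n) :
    ∃ a < 2 * n, ∃ b < 2 * n, v = fSp n a - fSp n b := by
  have hneg : ∀ δ : ℚ, (δ = 1 ∨ δ = -1) → (-δ = 1 ∨ -δ = -1) := by
    rintro δ (rfl | rfl) <;> simp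
  rcases hv with ⟨i, j, hij, hj, ε, δ, hε, hδ, rfl⟩ | ⟨i, hi, ε, hε, rfl⟩
  · obtain ⟨a, ha, ha'⟩ := exists_fSp (hij.trans hj) hε
    obtain ⟨b, hb, hb'⟩ := exists_fSp hj (hneg δ hδ)
    exact ⟨a, ha, b, hb, by rw [ha', hb', neg_smul, sub_neg_eq_add]⟩
  · obtain ⟨a, ha, ha'⟩ := exists_fSp hi hε
    obtain ⟨b, hb, hb'⟩ := exists_fSp hi (hneg ε hε)
    exact ⟨a, ha, b, hb, by rw [ha', hb', neg_smul, sub_neg_eq_add, two_smul, smul_add]⟩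

theorem phiC_comb {n : ℕ} {v : Fin n → ℚ} (hv : v ∈ PhiC n) : ∃ c : Fin n → ℤ,
      v = ∑ k : Fin n, (c k : ℚ) • alphaSp n (k : ℕ) ∧
      ((∀ k, 0 ≤ c k) ∨ (∀ k, c k ≤ 0)) := by
  obtain ⟨a, ha, b, hb, rfl⟩ := phiC_diff hv
  rcases le_total a b with h | h
  · obtain ⟨c, h1, h2⟩ := posSp_diff h hb
    exact ⟨c, h1, Or.inl h2⟩
  · obtain ⟨c, h1, h2⟩ := posSp_diff h ha
    refine ⟨fun k => -c k, ?_, Or.inr fun k => by simpa using h2 k⟩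
    simp only [Int.cast_neg, neg_smul, Finset.sum_neg_distrib]
    rw [← h1, neg_sub]

theorem sum_stdE {n i : ℕ} (hi : i < n) : ∑ j, stdE n i j = 1 := by
  rw [Finset.sum_eq_single (⟨i, hi⟩ : Fin n)]
  · simp [stdE]
  · intro b _ hb
    exact if_neg fun h => hb (Fin.ext h)
  · simp

theorem alphaSp_mem {n k : ℕ} (hk : k < n) : alphaSp n k ∈ PhiC n := by
  unfold alphaSp
  split_ifs with h
  · by_cases h2 : k / 2 = n - 1 - k / 2
    · exact Or.inr ⟨k / 2, by omega, 1, Or.inl rfl, by rw [← h2, one_smul, two_smul]⟩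
    · exact Or.inl ⟨k / 2, n - 1 - k / 2, by omega, by omega, 1, 1, Or.inl rfl, Or.inl rfl,
        by rw [one_smul, one_smul]⟩
  · by_cases h2 : n - (k + 1) / 2 = (k + 1) / 2
    · exact Or.inr ⟨(k + 1) / 2, by omega, -1, Or.inr rfl, by
        rw [h2, neg_one_smul, two_smul]; abel⟩
    · exact Or.inl ⟨(k + 1) / 2, n - (k + 1) / 2, by omega, by omega, -1, -1, Or.inr rfl,
        Or.inr rfl, by rw [neg_one_smul, neg_one_smul]; abel⟩

theorem sum_alphaSp {n k : ℕ} (hk : k < n) : ∑ j, alphaSp n k j ≠ 0 := by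
  unfold alphaSp
  split_ifs with h
  · simp only [Pi.add_apply, Finset.sum_add_distrib]
    rw [sum_stdE (by omega), sum_stdE (by omega)]; norm_num
  · simp only [Pi.sub_apply, Pi.neg_apply, Finset.sum_sub_distrib, Finset.sum_neg_distrib]
    rw [sum_stdE (by omega), sum_stdE (by omega)]; norm_num

theorem alphaSp_linInd (n : ℕ) : LinearIndependent ℚ (fun k : Fin n => alphaSp n (k : ℕ)) := by
  apply linearIndependent_of_top_le_span_of_card_eq_finrank _ (by simp)
  rw [← (Pi.basisFun ℚ (Fin n)).span_eq, Submodule.span_le]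
  rintro _ ⟨i, rfl⟩
  have h2 : (1 : ℚ) • ((2 : ℚ) • stdE n i) ∈ PhiC n := Or.inr ⟨i, i.2, 1, Or.inl rfl, rfl⟩
  obtain ⟨c, hc, -⟩ := phiC_comb h2
  have h3 : (Pi.basisFun ℚ (Fin n)) i = (1 / 2 : ℚ) • ((1 : ℚ) • ((2 : ℚ) • stdE n i)) := by
    ext j
    simp [stdE, Pi.single_apply, Fin.ext_iff]
  rw [h3, hc]
  exact Submodule.smul_mem _ _ (Submodule.sum_mem _ fun k _ =>
    Submodule.smul_mem _ _ (Submodule.subset_span ⟨k, rfl⟩))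


/-- `Δ_Sp` is a base (set of simple roots) of `Φ(Cₙ)`: each `αₖ` is a root, the `αₖ` are
linearly independent over `ℚ`, every root is an integer linear combination of the `αₖ` with
coefficients all nonnegative or all nonpositive, and no `αₖ` is of the form `±(eᵢ − eⱼ)`
with `i ≠ j` (i.e. every element of `Δ_Sp` is a non-compact root of `sp(2n,ℝ)`). -/
theorem deltaSp_isBase_of_PhiC (n : ℕ) (hn : 1 ≤ n) :
    (∀ k : Fin n, alphaSp n (k : ℕ) ∈ PhiC n) ∧
    LinearIndependent ℚ (fun k : Fin n => alphaSp n (k : ℕ)) ∧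
    (∀ v ∈ PhiC n, ∃ c : Fin n → ℤ,
      v = ∑ k : Fin n, (c k : ℚ) • alphaSp n (k : ℕ) ∧
      ((∀ k, 0 ≤ c k) ∨ (∀ k, c k ≤ 0))) ∧
    (∀ k : Fin n, ∀ i j : ℕ, i < n → j < n → i ≠ j →
      alphaSp n (k : ℕ) ≠ stdE n i - stdE n j ∧
      alphaSp n (k : ℕ) ≠ -(stdE n i - stdE n j)) := by
  refine ⟨fun k => alphaSp_mem k.2, alphaSp_linInd n, fun v hv => phiC_comb hv, ?_⟩
  intro k i j hi hj _
  have hs := sum_alphaSp k.2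
  constructor
  · intro h
    apply hs
    rw [h]
    simp only [Pi.sub_apply, Finset.sum_sub_distrib]
    rw [sum_stdE hi, sum_stdE hj, sub_self]
  · intro h
    apply hs
    rw [h]
    simp only [Pi.neg_apply, Pi.sub_apply, Finset.sum_neg_distrib, Finset.sum_sub_distrib]
    rw [sum_stdE hi, sum_stdE hj, sub_self, neg_zero]
end

section
/- Let n ≥ 1 and let Ψ(Δ_Sp) be the positive system of Φ(Cₙ) determined by the base Δ_Sp. Then eᵢ − eⱼ ∈ Ψ(Δ_Sp) for all 1 ≤ i < j ≤ n; that is, the positive system Ψ(Δ_Sp) contains all positive compact roots of sp(2n,ℝ) relative to its compact Cartan subalgebra. -/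
/-- The positive system `Ψ(Δ_Sp)` determined by the base `Δ_Sp`: the roots all of whose
coefficients relative to `Δ_Sp` are nonnegative. -/
def PsiSp (n : ℕ) : Set (Fin n → ℚ) :=
  {v | v ∈ PhiC n ∧ ∃ c : Fin n → ℤ,
    v = ∑ k : Fin n, (c k : ℚ) • alphaSp n (k : ℕ) ∧ ∀ k, 0 ≤ c k}

def ConeSp (n : ℕ) (v : Fin n → ℚ) : Prop :=
  ∃ c : Fin n → ℤ, v = ∑ k : Fin n, (c k : ℚ) • alphaSp n (k : ℕ) ∧ ∀ k, 0 ≤ c k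

theorem ConeSp.add' {n : ℕ} {v w : Fin n → ℚ} (hv : ConeSp n v) (hw : ConeSp n w) :
    ConeSp n (v + w) := by
  obtain ⟨c, rfl, hc⟩ := hv
  obtain ⟨d, rfl, hd⟩ := hw
  refine ⟨fun k => c k + d k, ?_, fun k => add_nonneg (hc k) (hd k)⟩
  rw [← Finset.sum_add_distrib]
  refine Finset.sum_congr rfl fun k _ => ?_
  push_cast
  rw [add_smul]

theorem coneSp_alpha {n k : ℕ} (hk : k < n) : ConeSp n (alphaSp n k) := by
  refine ⟨fun l => if l = ⟨k, hk⟩ then 1 else 0, ?_, fun l => by dsimp only; split_ifs <;> simp⟩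
  rw [Finset.sum_eq_single ⟨k, hk⟩]
  · simp
  · intro b _ hb
    simp [hb]
  · simp

theorem coneSp_step {n i : ℕ} (hi : i + 1 < n) : ConeSp n (stdE n i - stdE n (i + 1)) := by
  by_cases h : 2 * i + 1 < n
  · have := (coneSp_alpha (n := n) (k := 2 * i) (by omega)).add'
      (coneSp_alpha (n := n) (k := 2 * i + 1) h)
    convert this using 1
    unfold alphaSp
    rw [if_pos (by omega), if_neg (by omega), show 2 * i / 2 = i by omega,
      show (2 * i + 1 + 1) / 2 = i + 1 by omega, show n - (i + 1) = n - 1 - i by omega]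
    abel
  · obtain ⟨m, rfl⟩ : ∃ m, n = m + i + 2 := ⟨n - 2 - i, by omega⟩
    have := (coneSp_alpha (n := m + i + 2) (k := 2 * m + 1) (by omega)).add'
      (coneSp_alpha (n := m + i + 2) (k := 2 * m + 2) (by omega))
    convert this using 1
    unfold alphaSp
    rw [if_neg (by omega), if_pos (by omega), show (2 * m + 1 + 1) / 2 = m + 1 by omega,
      show m + i + 2 - (m + 1) = i + 1 by omega,
      show m + i + 2 - 1 - (m + 1) = i by omega]
    abel

theorem coneSp_sub {n i : ℕ} (d : ℕ) (h : i + d + 1 < n) :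
    ConeSp n (stdE n i - stdE n (i + d + 1)) := by
  induction d with
  | zero => exact coneSp_step h
  | succ d ih =>
    have := (ih (by omega)).add' (coneSp_step (n := n) (i := i + d + 1) (by omega))
    rwa [sub_add_sub_cancel] at this

/-- The positive system `Ψ(Δ_Sp)` contains all the positive compact roots `eᵢ − eⱼ`, `i < j`,
of `sp(2n,ℝ)` relative to its compact Cartan subalgebra. -/
theorem compact_pos_roots_mem_PsiSp (n : ℕ) (hn : 1 ≤ n) :
    ∀ i j : ℕ, i < j → j < n → stdE n i - stdE n j ∈ PsiSp n := by
  intro i j hij hj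
  refine ⟨Or.inl ⟨i, j, hij, hj, 1, -1, Or.inl rfl, Or.inr rfl, ?_⟩, ?_⟩
  · rw [one_smul, neg_one_smul, sub_eq_add_neg]
  · obtain ⟨d, rfl⟩ : ∃ d, j = i + d + 1 := ⟨j - i - 1, by omega⟩
    exact coneSp_sub d hj
end

section
/- Let n ≥ 1 and let Ψ(Δ_Sp) be the positive system of Φ(Cₙ) determined by the base Δ_Sp. Then the half-sum ρ = (1/2) Σ_{β ∈ Ψ(Δ_Sp)} β is the vector whose m-th coordinate equals n + 2 − 2m for 1 ≤ m ≤ ⌈n/2⌉ and whose (n+1−m)-th coordinate equals −(n + 1 − 2m) for 1 ≤ m ≤ ⌊n/2⌋. (Equivalently, ρ = λ_{d,Sp} for the choice λₖ = n + 1 − k.) -/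
/-- The half-sum `ρ = (1/2) Σ_{β ∈ Ψ(Δ_Sp)} β`. -/
noncomputable def rhoSp (n : ℕ) : Fin n → ℚ := ((1 : ℚ) / 2) • ∑ᶠ β ∈ PsiSp n, β


def FF (n k : ℕ) : Fin n → ℚ := if k % 2 = 0 then stdE n (k / 2) else -stdE n (n - 1 - k / 2)
def PP (n k : ℕ) : ℕ := if k % 2 = 0 then k / 2 else n - 1 - k / 2
def SS (k : ℕ) : ℚ := if k % 2 = 0 then 1 else -1
def WW (n x : ℕ) : ℚ := if 2 * x < n then (n : ℚ) - 2 * x else -(2 * x + 1 - n)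
def HH (n : ℕ) (v : Fin n → ℚ) : ℚ := ∑ x : Fin n, WW n x * v x
def ph (n : ℕ) (t : Fin n × Fin n) : Fin n → ℚ :=
  if t.1 < t.2 then FF n t.1 - FF n t.2 else FF n t.1 + FF n t.2
def NN (n : ℕ) (v : Fin n → ℚ) : Prop := ∃ c : Fin n → ℤ,
    v = ∑ k : Fin n, (c k : ℚ) • alphaSp n (k : ℕ) ∧ ∀ k, 0 ≤ c k

lemma PP_lt {n k : ℕ} (h : k < n) : PP n k < n := by unfold PP; split_ifs <;> omega

lemma PP_inj {n k l : ℕ} (h : k < n) (hl : l < n) (e : PP n k = PP n l) : k = l := by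
  unfold PP at e; split_ifs at e <;> omega

lemma SS_cases (k : ℕ) : SS k = 1 ∨ SS k = -1 := by unfold SS; split_ifs <;> simp

lemma FF_eq (n k : ℕ) : FF n k = SS k • stdE n (PP n k) := by
  unfold FF SS PP; split_ifs <;> simp

lemma FF_at {n k l : ℕ} (h : k < n) (hl : l < n) :
    FF n k ⟨PP n l, PP_lt hl⟩ = if k = l then SS l else 0 := by
  rw [FF_eq]
  simp only [stdE, Pi.smul_apply, smul_eq_mul]
  by_cases e : k = l
  · subst e; simp
  · have : ¬ PP n l = PP n k := fun e' => e (PP_inj hl h e').symm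
    simp [e, this]

lemma alpha_lt {n k : ℕ} (h : k + 1 < n) : alphaSp n k = FF n k - FF n (k+1) := by
  unfold alphaSp FF
  rcases Nat.even_or_odd' k with ⟨m, rfl | rfl⟩
  · have h1 : 2 * m % 2 = 0 := by omega
    have h2 : ¬ (2 * m + 1) % 2 = 0 := by omega
    have h3 : (2 * m + 1) / 2 = 2 * m / 2 := by omega
    simp only [h1, h2, h3, if_true, if_false]; abel
  · have h1 : (2 * m + 1 + 1) % 2 = 0 := by omega
    have h2 : ¬ (2 * m + 1) % 2 = 0 := by omega
    have h3 : n - (2 * m + 1 + 1) / 2 = n - 1 - (2 * m + 1) / 2 := by omega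
    simp only [h1, h2, h3, if_true, if_false]

lemma alpha_last {n k : ℕ} (h : k + 1 = n) : alphaSp n k = FF n k + FF n k := by
  subst h
  unfold alphaSp FF
  split_ifs with h1
  · have h3 : k + 1 - 1 - k / 2 = k / 2 := by omega
    rw [h3]
  · have h3 : k + 1 - (k + 1) / 2 = k + 1 - 1 - k / 2 := by omega
    have h4 : (k + 1) / 2 = k + 1 - 1 - k / 2 := by omega
    rw [h3, h4]; abel

lemma HH_add (n : ℕ) (v w : Fin n → ℚ) : HH n (v + w) = HH n v + HH n w := by
  simp [HH, mul_add, Finset.sum_add_distrib]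

lemma HH_neg (n : ℕ) (v : Fin n → ℚ) : HH n (-v) = - HH n v := by
  simp [HH]

lemma HH_sub (n : ℕ) (v w : Fin n → ℚ) : HH n (v - w) = HH n v - HH n w := by
  rw [sub_eq_add_neg, HH_add, HH_neg]; ring

lemma HH_smul (n : ℕ) (c : ℚ) (v : Fin n → ℚ) : HH n (c • v) = c * HH n v := by
  simp only [HH, Finset.mul_sum, Pi.smul_apply, smul_eq_mul]
  exact Finset.sum_congr rfl fun _ _ => by ring

lemma HH_sum (n : ℕ) (f : Fin n → Fin n → ℚ) : HH n (∑ k, f k) = ∑ k, HH n (f k) := by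
  simp only [HH, Finset.sum_apply, Finset.mul_sum]
  exact Finset.sum_comm

lemma HH_std {n a : ℕ} (h : a < n) : HH n (stdE n a) = WW n a := by
  unfold HH stdE
  rw [Finset.sum_eq_single (⟨a, h⟩ : Fin n)]
  · simp
  · intro b _ hb
    have : ¬ (b : ℕ) = a := fun e => hb (Fin.ext e)
    simp [this]
  · simp

lemma HH_FF {n k : ℕ} (h : k < n) : HH n (FF n k) = (n : ℚ) - k := by
  rw [FF_eq, HH_smul, HH_std (PP_lt h)]
  unfold SS WW PP
  rcases Nat.even_or_odd' k with ⟨m, rfl | rfl⟩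
  · have h1 : 2 * m % 2 = 0 := by omega
    have h2 : 2 * m / 2 = m := by omega
    simp only [h1, h2, if_true, h]; push_cast; ring
  · have h1 : ¬ (2 * m + 1) % 2 = 0 := by omega
    have h2 : (2 * m + 1) / 2 = m := by omega
    obtain ⟨r, rfl⟩ : ∃ r, n = r + 1 + m := ⟨n - 1 - m, by omega⟩
    have h3 : r + 1 + m - 1 - m = r := by omega
    have h4 : ¬ 2 * r < r + 1 + m := by omega
    simp only [h1, h2, h3, h4, if_false]; push_cast; ring

lemma HH_alpha {n k : ℕ} (h : k < n) : 0 ≤ HH n (alphaSp n k) := by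
  rcases Nat.lt_or_ge (k+1) n with h1 | h1
  · rw [alpha_lt h1, HH_sub, HH_FF h, HH_FF h1]; push_cast; linarith
  · rw [alpha_last (by omega), HH_add, HH_FF h]
    have : (k : ℚ) < n := by exact_mod_cast h
    linarith

lemma HH_NN {n : ℕ} {v : Fin n → ℚ} (h : NN n v) : 0 ≤ HH n v := by
  obtain ⟨c, rfl, hc⟩ := h
  rw [HH_sum]
  refine Finset.sum_nonneg fun k _ => ?_
  rw [HH_smul]
  exact mul_nonneg (by exact_mod_cast hc k) (HH_alpha k.2)

lemma HH_ph (n : ℕ) (t : Fin n × Fin n) : 0 < HH n (ph n t) := by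
  have h1 : ((t.1 : ℕ) : ℚ) < n := by exact_mod_cast t.1.2
  have h2 : ((t.2 : ℕ) : ℚ) < n := by exact_mod_cast t.2.2
  unfold ph
  split_ifs with h
  · rw [HH_sub, HH_FF t.1.2, HH_FF t.2.2]
    have : ((t.1 : ℕ) : ℚ) < (t.2 : ℕ) := by exact_mod_cast h
    linarith
  · rw [HH_add, HH_FF t.1.2, HH_FF t.2.2]
    linarith

lemma NN_zero (n : ℕ) : NN n 0 := ⟨0, by simp, by simp⟩

lemma NN_add {n : ℕ} {v w : Fin n → ℚ} (hv : NN n v) (hw : NN n w) : NN n (v + w) := by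
  obtain ⟨c, rfl, hc⟩ := hv
  obtain ⟨d, rfl, hd⟩ := hw
  refine ⟨c + d, ?_, fun k => add_nonneg (hc k) (hd k)⟩
  simp [add_smul, Finset.sum_add_distrib]

lemma NN_alpha {n k : ℕ} (h : k < n) : NN n (alphaSp n k) := by
  refine ⟨fun j => if j = ⟨k, h⟩ then 1 else 0, ?_, fun j => by dsimp only; split_ifs <;> simp⟩
  rw [Finset.sum_eq_single (⟨k, h⟩ : Fin n)]
  · simp
  · intro b _ hb
    simp [hb]
  · simp

lemma NN_sub {n i j : ℕ} (hij : i ≤ j) (h : j < n) : NN n (FF n i - FF n j) := by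
  induction j, hij using Nat.le_induction with
  | base => rw [sub_self]; exact NN_zero n
  | succ j hj ih =>
    have := NN_add (ih (by omega)) (NN_alpha (n := n) (k := j) (by omega))
    rw [alpha_lt h] at this
    convert this using 1
    abel

lemma NN_ph (n : ℕ) (t : Fin n × Fin n) : NN n (ph n t) := by
  unfold ph
  split_ifs with h
  · exact NN_sub (le_of_lt h) t.2.2
  · have h0 := t.1.2
    have h1 : NN n (FF n t.1 - FF n (n-1)) := NN_sub (by omega) (by omega)
    have h2 : NN n (FF n t.2 - FF n (n-1)) := NN_sub (by omega) (by omega)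
    have h3 := NN_alpha (n := n) (k := n - 1) (by omega)
    rw [alpha_last (by omega)] at h3
    convert NN_add (NN_add h1 h2) h3 using 1
    abel

lemma Phi_pair {n i j : ℕ} (hi : i < n) (hj : j < n) (hij : i ≠ j) (d : ℚ) (hd : d = 1 ∨ d = -1) :
    FF n i + d • FF n j ∈ PhiC n := by
  have hne : PP n i ≠ PP n j := fun e => hij (PP_inj hi hj e)
  have hs : d * SS j = 1 ∨ d * SS j = -1 := by
    rcases hd with rfl | rfl <;> rcases SS_cases j with h | h <;> simp [h]
  left
  rw [FF_eq, FF_eq, smul_smul]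
  rcases lt_or_gt_of_ne hne with h | h
  · exact ⟨_, _, h, PP_lt hj, _, _, SS_cases i, hs, rfl⟩
  · exact ⟨_, _, h, PP_lt hi, _, _, hs, SS_cases i, add_comm _ _⟩

lemma Phi_ph (n : ℕ) (t : Fin n × Fin n) : ph n t ∈ PhiC n := by
  unfold ph
  split_ifs with h
  · have := Phi_pair t.1.2 t.2.2 (by have : (t.1 : ℕ) < t.2 := h; omega) (-1) (Or.inr rfl)
    rwa [neg_one_smul, ← sub_eq_add_neg] at this
  · by_cases e : t.1 = t.2
    · right
      refine ⟨_, PP_lt t.2.2, _, SS_cases t.2, ?_⟩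
      rw [e, FF_eq, ← two_smul ℚ, smul_comm]
    · have := Phi_pair t.1.2 t.2.2 (fun e' => e (Fin.ext e')) 1 (Or.inl rfl)
      rwa [one_smul] at this

lemma std_FF {n a : ℕ} (h : a < n) : ∃ k, k < n ∧ PP n k = a ∧ stdE n a = SS k • FF n k := by
  have key : ∃ k, k < n ∧ PP n k = a := by
    unfold PP
    by_cases h2 : 2 * a < n
    · exact ⟨2 * a, h2, by rw [if_pos (by omega)]; omega⟩
    · exact ⟨2 * (n - 1 - a) + 1, by omega, by rw [if_neg (by omega)]; omega⟩
  obtain ⟨k, hk, rfl⟩ := key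
  refine ⟨k, hk, rfl, ?_⟩
  rw [FF_eq, smul_smul]
  rcases SS_cases k with h | h <;> simp [h]

lemma pair_ph {n i j : ℕ} (hi : i < n) (hj : j < n) (hij : i < j) (a b : ℚ)
    (ha : a = 1 ∨ a = -1) (hb : b = 1 ∨ b = -1) :
    ∃ t, a • FF n i + b • FF n j = ph n t ∨ a • FF n i + b • FF n j = - ph n t := by
  have e1 : ph n (⟨i, hi⟩, ⟨j, hj⟩) = FF n i - FF n j := by simp [ph, hij]
  have e2 : ph n (⟨j, hj⟩, ⟨i, hi⟩) = FF n j + FF n i := by simp [ph, hij.le]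
  rcases ha with rfl | rfl <;> rcases hb with rfl | rfl
  · exact ⟨_, Or.inl (by rw [e2]; module)⟩
  · exact ⟨_, Or.inl (by rw [e1]; module)⟩
  · exact ⟨_, Or.inr (by rw [e1]; module)⟩
  · exact ⟨_, Or.inr (by rw [e2]; module)⟩

lemma Phi_cases {n : ℕ} {v : Fin n → ℚ} (h : v ∈ PhiC n) :
    ∃ t, v = ph n t ∨ v = - ph n t := by
  rcases h with ⟨i, j, hij, hj, a, b, ha, hb, rfl⟩ | ⟨i, hi, a, ha, rfl⟩
  · obtain ⟨k, hk, hki, ek⟩ := std_FF (hij.trans hj)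
    obtain ⟨l, hl, hlj, el⟩ := std_FF hj
    have hkl : k ≠ l := by rintro rfl; omega
    have h1 : a * SS k = 1 ∨ a * SS k = -1 := by
      rcases ha with rfl | rfl <;> rcases SS_cases k with h | h <;> simp [h]
    have h2 : b * SS l = 1 ∨ b * SS l = -1 := by
      rcases hb with rfl | rfl <;> rcases SS_cases l with h | h <;> simp [h]
    rw [ek, el, smul_smul, smul_smul]
    rcases lt_or_gt_of_ne hkl with h | h
    · exact pair_ph hk hl h _ _ h1 h2
    · rw [add_comm]; exact pair_ph hl hk h _ _ h2 h1
  · obtain ⟨k, hk, hki, ek⟩ := std_FF hi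
    have h1 : a * SS k = 1 ∨ a * SS k = -1 := by
      rcases ha with rfl | rfl <;> rcases SS_cases k with h | h <;> simp [h]
    refine ⟨(⟨k, hk⟩, ⟨k, hk⟩), ?_⟩
    have e : ph n (⟨k, hk⟩, ⟨k, hk⟩) = FF n k + FF n k := by simp [ph]
    rw [e, ek, smul_comm (2 : ℚ), smul_smul]
    rcases h1 with h | h <;> rw [h]
    · left; module
    · right; module

lemma Psi_eq (n : ℕ) : PsiSp n = Set.range (ph n) := by
  ext v
  constructor
  · rintro ⟨h, hN⟩
    obtain ⟨t, rfl | rfl⟩ := Phi_cases h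
    · exact ⟨t, rfl⟩
    · have h1 := HH_NN (n := n) hN
      have h2 := HH_ph n t
      rw [HH_neg] at h1
      linarith
  · rintro ⟨t, rfl⟩
    exact ⟨Phi_ph n t, NN_ph n t⟩

lemma ph_at {n l : ℕ} (t : Fin n × Fin n) (hl : l < n) :
    ph n t ⟨PP n l, PP_lt hl⟩ = SS l * ((if (t.1 : ℕ) = l then 1 else 0) +
      (if (t.2 : ℕ) = l then (if (t.1 : ℕ) < l then -1 else 1) else 0)) := by
  unfold ph
  by_cases h : t.1 < t.2
  · have h' : (t.1 : ℕ) < t.2 := h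
    rw [if_pos h, Pi.sub_apply, FF_at t.1.2 hl, FF_at t.2.2 hl]
    split_ifs <;> first | omega | ring
  · have h' : ¬ (t.1 : ℕ) < t.2 := h
    rw [if_neg h, Pi.add_apply, FF_at t.1.2 hl, FF_at t.2.2 hl]
    split_ifs <;> first | omega | ring

lemma ph_inj (n : ℕ) : Function.Injective (ph n) := by
  rintro ⟨⟨i, hi⟩, ⟨j, hj⟩⟩ ⟨⟨i', hi'⟩, ⟨j', hj'⟩⟩ e
  have key : ∀ l, l < n → ((if i = l then (1:ℤ) else 0) +
      (if j = l then (if i < l then -1 else 1) else 0)) = ((if i' = l then 1 else 0) +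
      (if j' = l then (if i' < l then -1 else 1) else 0)) := by
    intro l hl
    have h := congrFun e ⟨PP n l, PP_lt hl⟩
    rw [ph_at _ hl, ph_at _ hl] at h
    have hs : SS l ≠ 0 := by rcases SS_cases l with h | h <;> simp [h]
    have h := mul_left_cancel₀ hs h
    exact_mod_cast h
  have k1 := key i hi
  have k2 := key j hj
  have k3 := key i' hi'
  have k4 := key j' hj'
  clear key e
  have : i = i' ∧ j = j' := by grind
  simp [this]

lemma sum_sgn (n l : ℕ) (hl : l < n) :
    ∑ i : Fin n, (if (i : ℕ) < l then (-1 : ℚ) else 1) = n - 2 * l := by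
  rw [Fin.sum_univ_eq_sum_range (fun i => if i < l then (-1 : ℚ) else 1)]
  obtain ⟨r, rfl⟩ := Nat.exists_eq_add_of_lt hl
  rw [add_assoc, Finset.sum_range_add]
  rw [Finset.sum_congr rfl (g := fun _ => (-1 : ℚ)) (fun x hx => if_pos (Finset.mem_range.mp hx))]
  simp
  ring

lemma rho_at {n l : ℕ} (hl : l < n) :
    rhoSp n ⟨PP n l, PP_lt hl⟩ = SS l * (n - l) := by
  unfold rhoSp
  rw [Psi_eq, finsum_mem_range (ph_inj n), finsum_eq_sum_of_fintype, Pi.smul_apply,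
    Finset.sum_apply, Fintype.sum_prod_type]
  simp only [ph_at _ hl, ← Finset.mul_sum, Finset.sum_add_distrib]
  have e (i : Fin n) : (i : ℕ) = l ↔ i = ⟨l, hl⟩ := by simp [Fin.ext_iff]
  have h1 : ∑ i : Fin n, ∑ j : Fin n, (if (i : ℕ) = l then (1 : ℚ) else 0) = n := by
    simp [e]
  have h2 : ∑ i : Fin n, ∑ j : Fin n, (if (j : ℕ) = l then (if (i : ℕ) < l then (-1 : ℚ) else 1)
      else 0) = n - 2 * l := by
    rw [← sum_sgn n l hl]
    simp [e]
  rw [h1, h2, smul_eq_mul]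
  ring

/-- The half-sum of the positive system `Ψ(Δ_Sp)` is the vector whose `m`-th coordinate is
`n + 2 − 2m` for `1 ≤ m ≤ ⌈n/2⌉` and whose `(n+1−m)`-th coordinate is `−(n + 1 − 2m)` for
`1 ≤ m ≤ ⌊n/2⌋` (coordinates written `1`-based; `m ≤ ⌈n/2⌉ ↔ 2m ≤ n+1`, `m ≤ ⌊n/2⌋ ↔ 2m ≤ n`). -/
theorem rhoSp_coords (n : ℕ) (hn : 1 ≤ n) :
    (∀ m : ℕ, ∀ (h1 : 1 ≤ m) (h2 : 2 * m ≤ n + 1),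
      rhoSp n ⟨m - 1, by omega⟩ = (n : ℚ) + 2 - 2 * (m : ℚ)) ∧
    (∀ m : ℕ, ∀ (h1 : 1 ≤ m) (h2 : 2 * m ≤ n),
      rhoSp n ⟨n - m, by omega⟩ = -((n : ℚ) + 1 - 2 * (m : ℚ))) := by
  constructor
  · intro m h1 h2
    obtain ⟨r, rfl⟩ := Nat.exists_eq_add_of_le' h1
    have h := rho_at (n := n) (l := 2 * r) (by omega)
    have hp : PP n (2 * r) = r + 1 - 1 := by
      unfold PP; rw [if_pos (by omega)]; omega
    have hs : SS (2 * r) = 1 := by unfold SS; rw [if_pos (by omega)]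
    simp only [hp, hs] at h
    rw [h]; push_cast; ring
  · intro m h1 h2
    obtain ⟨r, rfl⟩ := Nat.exists_eq_add_of_le' h1
    have h := rho_at (n := n) (l := 2 * r + 1) (by omega)
    have hp : PP n (2 * r + 1) = n - (r + 1) := by
      unfold PP; rw [if_neg (by omega)]; omega
    have hs : SS (2 * r + 1) = -1 := by unfold SS; rw [if_neg (by omega)]
    simp only [hp, hs] at h
    rw [h]; push_cast; ring
end

section
/- Let q₀ ≥ 0 and p₀ ≥ max(2, q₀ + 2). Then Δ_O' = {eᵢ − fᵢ : 1 ≤ i ≤ q₀} ∪ {fᵢ − e_{i+1} : 1 ≤ i ≤ q₀} ∪ {eⱼ − e_{j+1} : q₀+1 ≤ j ≤ p₀−1} ∪ {e_{p₀−1} + e_{p₀}} is a base (set of simple roots) of the root system Φ(D): each element of Δ_O' is a root, the elements of Δ_O' are linearly independent over ℚ, and every root β ∈ Φ(D) is an integer linear combination of elements of Δ_O' with coefficients either all nonnegative or all nonpositive. -/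
/-- The basis vector `e_{i+1}` of `ℚ^{p₀+q₀}` (`0`-based index `i < p₀`). -/
def EV (p₀ q₀ i : ℕ) : Fin (p₀ + q₀) → ℚ := fun k => if (k : ℕ) = i then 1 else 0

/-- The basis vector `f_{j+1}` of `ℚ^{p₀+q₀}` (`0`-based index `j < q₀`). -/
def FV (p₀ q₀ j : ℕ) : Fin (p₀ + q₀) → ℚ := fun k => if (k : ℕ) = p₀ + j then 1 else 0

/-- The root system of type `D_{p₀+q₀}`:
`Φ(D) = {±eᵢ ± eⱼ : i < j ≤ p₀} ∪ {±fᵢ ± fⱼ : i < j ≤ q₀} ∪ {±eᵢ ± fⱼ}` (written `0`-based). -/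
def PhiD (p₀ q₀ : ℕ) : Set (Fin (p₀ + q₀) → ℚ) :=
  {v | (∃ i j : ℕ, i < j ∧ j < p₀ ∧ ∃ ε δ : ℚ, (ε = 1 ∨ ε = -1) ∧ (δ = 1 ∨ δ = -1) ∧
          v = ε • EV p₀ q₀ i + δ • EV p₀ q₀ j) ∨
       (∃ i j : ℕ, i < j ∧ j < q₀ ∧ ∃ ε δ : ℚ, (ε = 1 ∨ ε = -1) ∧ (δ = 1 ∨ δ = -1) ∧
          v = ε • FV p₀ q₀ i + δ • FV p₀ q₀ j) ∨
       (∃ i j : ℕ, i < p₀ ∧ j < q₀ ∧ ∃ ε δ : ℚ, (ε = 1 ∨ ε = -1) ∧ (δ = 1 ∨ δ = -1) ∧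
          v = ε • EV p₀ q₀ i + δ • FV p₀ q₀ j)}

/-- An enumeration (`0`-based index `k < p₀+q₀`) of the simple roots
`Δ_O' = {eᵢ − fᵢ : 1 ≤ i ≤ q₀} ∪ {fᵢ − e_{i+1} : 1 ≤ i ≤ q₀} ∪
{eⱼ − e_{j+1} : q₀+1 ≤ j ≤ p₀−1} ∪ {e_{p₀−1} + e_{p₀}}` (for `p₀ ≥ max(2, q₀+2)`),
interleaved as `e₁−f₁, f₁−e₂, …, f_{q₀}−e_{q₀+1}`, then `e_{q₀+1}−e_{q₀+2}, …, e_{p₀−1}−e_{p₀}`,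
ending with `e_{p₀−1}+e_{p₀}`. -/
def deltaO' (p₀ q₀ k : ℕ) : Fin (p₀ + q₀) → ℚ :=
  if k + 1 = p₀ + q₀ then EV p₀ q₀ (p₀ - 2) + EV p₀ q₀ (p₀ - 1)
  else if k < 2 * q₀ then
    (if k % 2 = 0 then EV p₀ q₀ (k / 2) - FV p₀ q₀ (k / 2)
     else FV p₀ q₀ (k / 2) - EV p₀ q₀ (k / 2 + 1))
  else EV p₀ q₀ (k - q₀) - EV p₀ q₀ (k - q₀ + 1)

/-- ordered basis -/
def UV (p₀ q₀ k : ℕ) : Fin (p₀ + q₀) → ℚ :=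
  if k < 2 * q₀ then (if k % 2 = 0 then EV p₀ q₀ (k / 2) else FV p₀ q₀ (k / 2))
  else EV p₀ q₀ (k - q₀)

/-- nonnegative integer combinations -/
def PosC (p₀ q₀ : ℕ) (v : Fin (p₀ + q₀) → ℚ) : Prop :=
  ∃ c : Fin (p₀ + q₀) → ℤ, v = ∑ k : Fin (p₀ + q₀), (c k : ℚ) • deltaO' p₀ q₀ (k : ℕ) ∧
    ∀ k, 0 ≤ c k

lemma PosC.plus {p₀ q₀ : ℕ} {v w : Fin (p₀ + q₀) → ℚ} (hv : PosC p₀ q₀ v) (hw : PosC p₀ q₀ w) :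
    PosC p₀ q₀ (v + w) := by
  obtain ⟨c, rfl, hc⟩ := hv
  obtain ⟨d, rfl, hd⟩ := hw
  refine ⟨c + d, ?_, fun k => add_nonneg (hc k) (hd k)⟩
  simp [add_smul, Finset.sum_add_distrib]

lemma posC_zero (p₀ q₀ : ℕ) : PosC p₀ q₀ 0 := ⟨0, by simp, by simp⟩

lemma posC_delta (p₀ q₀ k : ℕ) (hk : k < p₀ + q₀) : PosC p₀ q₀ (deltaO' p₀ q₀ k) := by
  refine ⟨Pi.single ⟨k, hk⟩ 1, ?_, ?_⟩
  · rw [Finset.sum_eq_single ⟨k, hk⟩]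
    · simp
    · intro b _ hb
      simp [hb]
    · simp
  · intro j
    by_cases h : j = ⟨k, hk⟩
    · subst h; simp
    · simp [h]

lemma delta_eq (p₀ q₀ k : ℕ) (hpq : q₀ + 2 ≤ p₀) (hk : k + 1 < p₀ + q₀) :
    deltaO' p₀ q₀ k = UV p₀ q₀ k - UV p₀ q₀ (k + 1) := by
  unfold deltaO' UV
  rw [if_neg (by omega)]
  by_cases h : k < 2 * q₀
  · rw [if_pos h, if_pos h]
    by_cases h2 : k % 2 = 0
    · rw [if_pos h2, if_pos h2, if_pos (by omega), if_neg (by omega),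
        show (k + 1) / 2 = k / 2 by omega]
    · rw [if_neg h2, if_neg h2]
      by_cases h3 : k + 1 < 2 * q₀
      · rw [if_pos h3, if_pos (by omega), show (k + 1) / 2 = k / 2 + 1 by omega]
      · rw [if_neg h3, show k + 1 - q₀ = k / 2 + 1 by omega]
  · rw [if_neg h, if_neg h, if_neg (by omega), show k + 1 - q₀ = k - q₀ + 1 by omega]

lemma delta_last (p₀ q₀ : ℕ) (hpq : q₀ + 2 ≤ p₀) :
    deltaO' p₀ q₀ (p₀ + q₀ - 1) = UV p₀ q₀ (p₀ + q₀ - 2) + UV p₀ q₀ (p₀ + q₀ - 1) := by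
  unfold deltaO' UV
  rw [if_pos (by omega), if_neg (by omega), if_neg (by omega),
    show p₀ + q₀ - 2 - q₀ = p₀ - 2 by omega, show p₀ + q₀ - 1 - q₀ = p₀ - 1 by omega]

lemma posC_sub (p₀ q₀ a b : ℕ) (hpq : q₀ + 2 ≤ p₀) (hab : a ≤ b) (hb : b < p₀ + q₀) :
    PosC p₀ q₀ (UV p₀ q₀ a - UV p₀ q₀ b) := by
  induction b, hab using Nat.le_induction with
  | base => simpa using posC_zero p₀ q₀
  | succ m hm ih =>
    have h := (ih (by omega)).plus (posC_delta p₀ q₀ m (by omega))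
    rw [delta_eq p₀ q₀ m hpq hb] at h
    simpa using h

lemma posC_add (p₀ q₀ a b : ℕ) (hpq : q₀ + 2 ≤ p₀) (hab : a < b) (hb : b < p₀ + q₀) :
    PosC p₀ q₀ (UV p₀ q₀ a + UV p₀ q₀ b) := by
  have h1 := posC_sub p₀ q₀ a (p₀ + q₀ - 2) hpq (by omega) (by omega)
  have h2 := posC_sub p₀ q₀ b (p₀ + q₀ - 1) hpq (by omega) (by omega)
  have h3 := posC_delta p₀ q₀ (p₀ + q₀ - 1) (by omega)
  rw [delta_last p₀ q₀ hpq] at h3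
  have h := (h1.plus h2).plus h3
  convert h using 1
  abel

lemma EV_eq (p₀ q₀ i : ℕ) : EV p₀ q₀ i = UV p₀ q₀ (if i < q₀ then 2 * i else i + q₀) := by
  unfold UV
  by_cases h : i < q₀
  · rw [if_pos h, if_pos (by omega), if_pos (by omega), show 2 * i / 2 = i by omega]
  · rw [if_neg h, if_neg (by omega), show i + q₀ - q₀ = i by omega]

lemma FV_eq (p₀ q₀ i : ℕ) (h : i < q₀) : FV p₀ q₀ i = UV p₀ q₀ (2 * i + 1) := by
  unfold UV
  rw [if_pos (by omega), if_neg (by omega), show (2 * i + 1) / 2 = i by omega]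

/-- the sign-coherent property -/
def Coh (p₀ q₀ : ℕ) (v : Fin (p₀ + q₀) → ℚ) : Prop :=
  ∃ c : Fin (p₀ + q₀) → ℤ,
      v = ∑ k : Fin (p₀ + q₀), (c k : ℚ) • deltaO' p₀ q₀ (k : ℕ) ∧
      ((∀ k, 0 ≤ c k) ∨ (∀ k, c k ≤ 0))

lemma PosC.coh {p₀ q₀ : ℕ} {v : Fin (p₀ + q₀) → ℚ} (h : PosC p₀ q₀ v) : Coh p₀ q₀ v := by
  obtain ⟨c, h, hc⟩ := h
  exact ⟨c, h, Or.inl hc⟩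

lemma PosC.coh_neg {p₀ q₀ : ℕ} {v : Fin (p₀ + q₀) → ℚ} (h : PosC p₀ q₀ (-v)) : Coh p₀ q₀ v := by
  obtain ⟨c, h, hc⟩ := h
  refine ⟨-c, ?_, Or.inr fun k => by simpa using hc k⟩
  rw [← neg_neg v, h]
  simp

lemma coh_lt (p₀ q₀ a b : ℕ) (hpq : q₀ + 2 ≤ p₀) (hab : a < b) (hb : b < p₀ + q₀)
    (ε δ : ℚ) (hε : ε = 1 ∨ ε = -1) (hδ : δ = 1 ∨ δ = -1) :
    Coh p₀ q₀ (ε • UV p₀ q₀ a + δ • UV p₀ q₀ b) := by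
  have h1 := posC_sub p₀ q₀ a b hpq hab.le hb
  have h2 := posC_add p₀ q₀ a b hpq hab hb
  rcases hε with rfl | rfl <;> rcases hδ with rfl | rfl
  · apply PosC.coh; convert h2 using 1; module
  · apply PosC.coh; convert h1 using 1; module
  · apply PosC.coh_neg; convert h1 using 1; module
  · apply PosC.coh_neg; convert h2 using 1; module

lemma coh_ne (p₀ q₀ a b : ℕ) (hpq : q₀ + 2 ≤ p₀) (hab : a ≠ b) (ha : a < p₀ + q₀)
    (hb : b < p₀ + q₀) (ε δ : ℚ) (hε : ε = 1 ∨ ε = -1) (hδ : δ = 1 ∨ δ = -1) :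
    Coh p₀ q₀ (ε • UV p₀ q₀ a + δ • UV p₀ q₀ b) := by
  rcases lt_or_gt_of_ne hab with h | h
  · exact coh_lt p₀ q₀ a b hpq h hb ε δ hε hδ
  · rw [add_comm]
    exact coh_lt p₀ q₀ b a hpq h ha δ ε hδ hε

lemma coh_of_mem (p₀ q₀ : ℕ) (hpq : q₀ + 2 ≤ p₀) (v : Fin (p₀ + q₀) → ℚ)
    (hv : v ∈ PhiD p₀ q₀) : Coh p₀ q₀ v := by
  rcases hv with ⟨i, j, hij, hj, ε, δ, hε, hδ, rfl⟩ | ⟨i, j, hij, hj, ε, δ, hε, hδ, rfl⟩ |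
    ⟨i, j, hij, hj, ε, δ, hε, hδ, rfl⟩
  · rw [EV_eq p₀ q₀ i, EV_eq p₀ q₀ j]
    apply coh_ne _ _ _ _ hpq _ _ _ _ _ hε hδ <;> split_ifs <;> omega
  · rw [FV_eq p₀ q₀ i (by omega), FV_eq p₀ q₀ j (by omega)]
    apply coh_ne _ _ _ _ hpq _ _ _ _ _ hε hδ <;> omega
  · rw [EV_eq p₀ q₀ i, FV_eq p₀ q₀ j (by omega)]
    apply coh_ne _ _ _ _ hpq _ _ _ _ _ hε hδ <;> (try split_ifs) <;> omega

lemma PosC.mem_span {p₀ q₀ : ℕ} {v : Fin (p₀ + q₀) → ℚ} (h : PosC p₀ q₀ v) :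
    v ∈ Submodule.span ℚ (Set.range (fun k : Fin (p₀ + q₀) => deltaO' p₀ q₀ (k : ℕ))) := by
  obtain ⟨c, rfl, -⟩ := h
  exact Submodule.sum_mem _ fun k _ => Submodule.smul_mem _ _ (Submodule.subset_span ⟨k, rfl⟩)

lemma UV_mem_span (p₀ q₀ a : ℕ) (hpq : q₀ + 2 ≤ p₀) (ha : a < p₀ + q₀) :
    UV p₀ q₀ a ∈
      Submodule.span ℚ (Set.range (fun k : Fin (p₀ + q₀) => deltaO' p₀ q₀ (k : ℕ))) := by
  have h1 := (posC_sub p₀ q₀ (p₀ + q₀ - 2) (p₀ + q₀ - 1) hpq (by omega) (by omega)).mem_span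
  have h2 := (posC_add p₀ q₀ (p₀ + q₀ - 2) (p₀ + q₀ - 1) hpq (by omega) (by omega)).mem_span
  have h3 := (posC_sub p₀ q₀ a (p₀ + q₀ - 1) hpq (by omega) (by omega)).mem_span
  have h := Submodule.add_mem _ h3 (Submodule.smul_mem _ (1 / 2 : ℚ) (Submodule.sub_mem _ h2 h1))
  convert h using 1
  module

lemma delta_linInd (p₀ q₀ : ℕ) (hpq : q₀ + 2 ≤ p₀) :
    LinearIndependent ℚ (fun k : Fin (p₀ + q₀) => deltaO' p₀ q₀ (k : ℕ)) := by
  apply linearIndependent_of_top_le_span_of_card_eq_finrank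
  · rw [← (Pi.basisFun ℚ (Fin (p₀ + q₀))).span_eq, Submodule.span_le]
    rintro _ ⟨k, rfl⟩
    have hk := k.2
    by_cases h : (k : ℕ) < p₀
    · have : Pi.basisFun ℚ (Fin (p₀ + q₀)) k = EV p₀ q₀ k := by
        ext j
        simp [EV, Pi.single_apply, Fin.ext_iff]
      rw [this, EV_eq]
      exact UV_mem_span _ _ _ hpq (by split_ifs <;> omega)
    · have : Pi.basisFun ℚ (Fin (p₀ + q₀)) k = FV p₀ q₀ (k - p₀) := by
        ext j
        simp [FV, Pi.single_apply, Fin.ext_iff, show p₀ + ((k : ℕ) - p₀) = k by omega]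
      rw [this, FV_eq _ _ _ (by omega)]
      exact UV_mem_span _ _ _ hpq (by omega)
  · simp

lemma delta_range (p₀ q₀ : ℕ) (hpq : q₀ + 2 ≤ p₀) :
    (Set.range (fun k : Fin (p₀ + q₀) => deltaO' p₀ q₀ (k : ℕ)) =
      {v | (∃ i : ℕ, i < q₀ ∧ v = EV p₀ q₀ i - FV p₀ q₀ i) ∨
           (∃ i : ℕ, i < q₀ ∧ v = FV p₀ q₀ i - EV p₀ q₀ (i + 1)) ∨
           (∃ j : ℕ, q₀ ≤ j ∧ j + 1 < p₀ ∧ v = EV p₀ q₀ j - EV p₀ q₀ (j + 1)) ∨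
           v = EV p₀ q₀ (p₀ - 2) + EV p₀ q₀ (p₀ - 1)}) := by
  ext v
  constructor
  · rintro ⟨⟨k, hk⟩, rfl⟩
    simp only [deltaO', Set.mem_setOf_eq]
    split_ifs with h1 h2 h3
    · exact Or.inr (Or.inr (Or.inr rfl))
    · exact Or.inl ⟨k / 2, by omega, rfl⟩
    · exact Or.inr (Or.inl ⟨k / 2, by omega, rfl⟩)
    · exact Or.inr (Or.inr (Or.inl ⟨k - q₀, by omega, by omega, rfl⟩))
  · rintro (⟨i, hi, rfl⟩ | ⟨i, hi, rfl⟩ | ⟨i, hi, hi2, rfl⟩ | rfl)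
    · refine ⟨⟨2 * i, by omega⟩, ?_⟩
      simp only [deltaO']
      rw [if_neg (by omega), if_pos (by omega), if_pos (by omega), show 2 * i / 2 = i by omega]
    · refine ⟨⟨2 * i + 1, by omega⟩, ?_⟩
      simp only [deltaO']
      rw [if_neg (by omega), if_pos (by omega), if_neg (by omega),
        show (2 * i + 1) / 2 = i by omega]
    · refine ⟨⟨i + q₀, by omega⟩, ?_⟩
      simp only [deltaO']
      rw [if_neg (by omega), if_neg (by omega), show i + q₀ - q₀ = i by omega]
    · refine ⟨⟨p₀ + q₀ - 1, by omega⟩, ?_⟩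
      simp only [deltaO']
      rw [if_pos (by omega)]

lemma delta_mem (p₀ q₀ : ℕ) (hpq : q₀ + 2 ≤ p₀) (k : Fin (p₀ + q₀)) :
    deltaO' p₀ q₀ (k : ℕ) ∈ PhiD p₀ q₀ := by
  have h : deltaO' p₀ q₀ (k : ℕ) ∈
    Set.range (fun k : Fin (p₀ + q₀) => deltaO' p₀ q₀ (k : ℕ)) := ⟨k, rfl⟩
  rw [delta_range p₀ q₀ hpq] at h
  rcases h with ⟨i, hi, h⟩ | ⟨i, hi, h⟩ | ⟨i, hi, hi2, h⟩ | h <;> rw [h]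
  · exact Or.inr (Or.inr ⟨i, i, by omega, hi, 1, -1, by simp, by simp, by module⟩)
  · exact Or.inr (Or.inr ⟨i + 1, i, by omega, hi, -1, 1, by simp, by simp, by module⟩)
  · exact Or.inl ⟨i, i + 1, by omega, hi2, 1, -1, by simp, by simp, by module⟩
  · exact Or.inl ⟨p₀ - 2, p₀ - 1, by omega, by omega, 1, 1, by simp, by simp, by module⟩

/-- For `q₀ ≥ 0` and `p₀ ≥ max(2, q₀+2)`, `Δ_O'` is a base of `Φ(D)`: its elements are roots,
it enumerates exactly the claimed set, it is linearly independent over `ℚ`, and every root is an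
integer combination of its elements with coefficients all nonnegative or all nonpositive. -/
theorem deltaO'_isBase_of_PhiD (p₀ q₀ : ℕ) (hp2 : 2 ≤ p₀) (hpq : q₀ + 2 ≤ p₀) :
    (∀ k : Fin (p₀ + q₀), deltaO' p₀ q₀ (k : ℕ) ∈ PhiD p₀ q₀) ∧
    (Set.range (fun k : Fin (p₀ + q₀) => deltaO' p₀ q₀ (k : ℕ)) =
      {v | (∃ i : ℕ, i < q₀ ∧ v = EV p₀ q₀ i - FV p₀ q₀ i) ∨
           (∃ i : ℕ, i < q₀ ∧ v = FV p₀ q₀ i - EV p₀ q₀ (i + 1)) ∨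
           (∃ j : ℕ, q₀ ≤ j ∧ j + 1 < p₀ ∧ v = EV p₀ q₀ j - EV p₀ q₀ (j + 1)) ∨
           v = EV p₀ q₀ (p₀ - 2) + EV p₀ q₀ (p₀ - 1)}) ∧
    LinearIndependent ℚ (fun k : Fin (p₀ + q₀) => deltaO' p₀ q₀ (k : ℕ)) ∧
    (∀ v ∈ PhiD p₀ q₀, ∃ c : Fin (p₀ + q₀) → ℤ,
      v = ∑ k : Fin (p₀ + q₀), (c k : ℚ) • deltaO' p₀ q₀ (k : ℕ) ∧
      ((∀ k, 0 ≤ c k) ∨ (∀ k, c k ≤ 0))) := by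
  exact ⟨delta_mem p₀ q₀ hpq, delta_range p₀ q₀ hpq, delta_linInd p₀ q₀ hpq,
    coh_of_mem p₀ q₀ hpq⟩
end

section
/- With notation as in the context: (a) if q₀ ≥ 1 and p₀ ∈ {q₀, q₀+1}, then the positive system Ψ(Δ_O) determined by the base Δ_O contains eᵢ − eⱼ for all 1 ≤ i < j ≤ p₀ and fᵢ − fⱼ for all 1 ≤ i < j ≤ q₀; (b) if q₀ ≥ 0 and p₀ ≥ max(2, q₀+2), then the positive system Ψ(Δ_O') determined by the base Δ_O' contains eᵢ − eⱼ for all 1 ≤ i < j ≤ p₀ and fᵢ − fⱼ for all 1 ≤ i < j ≤ q₀. In other words, in both cases the positive system contains all positive compact roots of so(2p₀, 2q₀) relative to its compact Cartan subalgebra. -/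
/-- Enumeration of the simple roots `Δ_O` (case `q₀ ≥ 1`, `p₀ ∈ {q₀, q₀+1}`). -/
def deltaO (p₀ q₀ k : ℕ) : Fin (p₀ + q₀) → ℚ :=
  if k + 1 = p₀ + q₀ then EV p₀ q₀ (p₀ - 1) + FV p₀ q₀ (q₀ - 1)
  else if k % 2 = 0 then EV p₀ q₀ (k / 2) - FV p₀ q₀ (k / 2)
  else FV p₀ q₀ (k / 2) - EV p₀ q₀ (k / 2 + 1)

/-- The positive system `Ψ(Δ_O)` determined by `Δ_O`. -/
def PsiO (p₀ q₀ : ℕ) : Set (Fin (p₀ + q₀) → ℚ) :=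
  {v | v ∈ PhiD p₀ q₀ ∧ ∃ c : Fin (p₀ + q₀) → ℤ,
    v = ∑ k : Fin (p₀ + q₀), (c k : ℚ) • deltaO p₀ q₀ (k : ℕ) ∧ ∀ k, 0 ≤ c k}

/-- The positive system `Ψ(Δ_O')` determined by `Δ_O'`. -/
def PsiO' (p₀ q₀ : ℕ) : Set (Fin (p₀ + q₀) → ℚ) :=
  {v | v ∈ PhiD p₀ q₀ ∧ ∃ c : Fin (p₀ + q₀) → ℤ,
    v = ∑ k : Fin (p₀ + q₀), (c k : ℚ) • deltaO' p₀ q₀ (k : ℕ) ∧ ∀ k, 0 ≤ c k}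

theorem chain_aux {V : Type*} [AddCommGroup V] [Module ℚ V] (n : ℕ) (d w : ℕ → V)
    (h : ∀ k, k + 1 < n → d k = w k - w (k + 1)) (a b : ℕ) (hab : a ≤ b) (hb : b < n) :
    ∃ c : Fin n → ℤ, w a - w b = ∑ k : Fin n, (c k : ℚ) • d (k : ℕ) ∧ ∀ k, 0 ≤ c k := by
  induction b, hab using Nat.le_induction with
  | base => exact ⟨fun _ => 0, by simp, by simp⟩
  | succ b hab ih =>
    obtain ⟨c, hc, hc0⟩ := ih (by omega)
    refine ⟨fun k => c k + if k = (⟨b, by omega⟩ : Fin n) then 1 else 0, ?_, ?_⟩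
    · have : w a - w (b + 1) = (w a - w b) + d b := by rw [h b hb]; abel
      rw [this, hc]
      simp [add_smul, Finset.sum_add_distrib, ite_smul]
    · intro k
      have := hc0 k
      dsimp only
      split_ifs <;> omega

def wA (p q k : ℕ) : Fin (p + q) → ℚ := if k % 2 = 0 then EV p q (k / 2) else FV p q (k / 2)

def wB (p q k : ℕ) : Fin (p + q) → ℚ := if k < 2 * q then wA p q k else EV p q (k - q)

theorem wA_even (p q i : ℕ) : wA p q (2 * i) = EV p q i := by simp [wA]

theorem wA_odd (p q i : ℕ) : wA p q (2 * i + 1) = FV p q i := by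
  have h1 : (2 * i + 1) % 2 = 1 := by omega
  have h2 : (2 * i + 1) / 2 = i := by omega
  simp [wA, h1, h2]

theorem hA (p q k : ℕ) (hk : k + 1 < p + q) : deltaO p q k = wA p q k - wA p q (k + 1) := by
  rw [deltaO, if_neg (by omega)]
  rcases Nat.even_or_odd' k with ⟨i, rfl | rfl⟩
  · rw [wA_even, wA_odd]; simp
  · have h1 : (2 * i + 1) % 2 = 1 := by omega
    have h2 : (2 * i + 1) / 2 = i := by omega
    rw [wA_odd, show 2 * i + 1 + 1 = 2 * (i + 1) by ring, wA_even]; simp [h1, h2]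

theorem hB (p q k : ℕ) (hk : k + 1 < p + q) : deltaO' p q k = wB p q k - wB p q (k + 1) := by
  rw [deltaO', if_neg (by omega)]
  by_cases hq : k < 2 * q
  · have := hA p q k hk
    rw [deltaO, if_neg (by omega)] at this
    rw [if_pos hq, this, wB, if_pos hq, wB]
    split_ifs with h
    · rfl
    · have : k + 1 = 2 * q := by omega
      rw [this, wA_even, show 2 * q - q = q by omega]
  · rw [if_neg hq, wB, if_neg hq, wB, if_neg (by omega), show k + 1 - q = k - q + 1 by omega]

theorem wB_odd (p q i : ℕ) (h : i < q) : wB p q (2 * i + 1) = FV p q i := by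
  rw [wB, if_pos (by omega), wA_odd]

theorem wB_E (p q i : ℕ) : wB p q (if i < q then 2 * i else i + q) = EV p q i := by
  split_ifs with h
  · rw [wB, if_pos (by omega), wA_even]
  · rw [wB, if_neg (by omega)]; simp

theorem phiE (p q i j : ℕ) (h : i < j) (hj : j < p) : EV p q i - EV p q j ∈ PhiD p q :=
  Or.inl ⟨i, j, h, hj, 1, -1, by simp, by simp, by simp [sub_eq_add_neg]⟩

theorem phiF (p q i j : ℕ) (h : i < j) (hj : j < q) : FV p q i - FV p q j ∈ PhiD p q :=
  Or.inr (Or.inl ⟨i, j, h, hj, 1, -1, by simp, by simp, by simp [sub_eq_add_neg]⟩)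

/-- (a) For `q₀ ≥ 1`, `p₀ ∈ {q₀, q₀+1}`, the positive system `Ψ(Δ_O)` contains all positive
compact roots `eᵢ − eⱼ` (`i < j ≤ p₀`) and `fᵢ − fⱼ` (`i < j ≤ q₀`); (b) for
`p₀ ≥ max(2, q₀+2)`, the same holds for `Ψ(Δ_O')`. -/
theorem compact_pos_roots_mem_PsiO (p₀ q₀ : ℕ) :
    (1 ≤ q₀ → (p₀ = q₀ ∨ p₀ = q₀ + 1) →
      (∀ i j : ℕ, i < j → j < p₀ → EV p₀ q₀ i - EV p₀ q₀ j ∈ PsiO p₀ q₀) ∧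
      (∀ i j : ℕ, i < j → j < q₀ → FV p₀ q₀ i - FV p₀ q₀ j ∈ PsiO p₀ q₀)) ∧
    (2 ≤ p₀ → q₀ + 2 ≤ p₀ →
      (∀ i j : ℕ, i < j → j < p₀ → EV p₀ q₀ i - EV p₀ q₀ j ∈ PsiO' p₀ q₀) ∧
      (∀ i j : ℕ, i < j → j < q₀ → FV p₀ q₀ i - FV p₀ q₀ j ∈ PsiO' p₀ q₀)) := by
  refine ⟨fun h1 h2 => ⟨fun i j hij hj => ⟨phiE _ _ _ _ hij hj, ?_⟩,
      fun i j hij hj => ⟨phiF _ _ _ _ hij hj, ?_⟩⟩,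
    fun h1 h2 => ⟨fun i j hij hj => ⟨phiE _ _ _ _ hij hj, ?_⟩,
      fun i j hij hj => ⟨phiF _ _ _ _ hij hj, ?_⟩⟩⟩
  · rw [← wA_even, ← wA_even]
    exact chain_aux _ _ _ (hA p₀ q₀) _ _ (by omega) (by omega)
  · rw [← wA_odd, ← wA_odd]
    exact chain_aux _ _ _ (hA p₀ q₀) _ _ (by omega) (by omega)
  · rw [← wB_E p₀ q₀ i, ← wB_E p₀ q₀ j]
    exact chain_aux _ _ _ (hB p₀ q₀) _ _ (by split_ifs <;> omega) (by split_ifs <;> omega)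
  · rw [← wB_odd p₀ q₀ i (by omega), ← wB_odd p₀ q₀ j hj]
    exact chain_aux _ _ _ (hB p₀ q₀) _ _ (by omega) (by omega)
end

section
/- Let n ≥ 1. Declare two vectors v, v' ∈ ℚⁿ equivalent, written v ~ v', if there exist a permutation σ of {1,…,n}, signs ε₁,…,εₙ ∈ {+1, −1}, and u ∈ (2ℤ)ⁿ such that v'ᵢ = εᵢ·v_{σ(i)} + uᵢ for all i. Then every v ∈ ℤⁿ ∪ (ℤ + 1/2)ⁿ is equivalent to exactly one of the following n + 2 vectors: the vector (1/2, 1/2, …, 1/2), or the vector (1,…,1,0,…,0) with p entries equal to 1 followed by n − p entries equal to 0, for some 0 ≤ p ≤ n. In particular, ℤⁿ ∪ (ℤ + 1/2)ⁿ decomposes into exactly n + 2 equivalence classes under ~, and these listed representatives are pairwise inequivalent. -/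
/-- The set `ℤⁿ ∪ (ℤ + 1/2)ⁿ ⊂ ℚⁿ`: vectors all of whose coordinates are integers, or all
of whose coordinates are half-odd-integers. -/
def WOmega (n : ℕ) : Set (Fin n → ℚ) :=
  {v | (∀ i, ∃ m : ℤ, v i = m) ∨ (∀ i, ∃ m : ℤ, v i = m + 1 / 2)}

/-- `v ~ v'` iff there are a permutation `σ`, signs `εᵢ ∈ {±1}` and `u ∈ (2ℤ)ⁿ` with
`v'ᵢ = εᵢ · v_{σ(i)} + uᵢ` for all `i` (Weyl group of type `Cₙ` together with translation by
the lattice `2ℤⁿ`). -/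
def weylEquiv (n : ℕ) (v v' : Fin n → ℚ) : Prop :=
  ∃ (σ : Equiv.Perm (Fin n)) (ε : Fin n → ℚ) (u : Fin n → ℤ),
    (∀ i, ε i = 1 ∨ ε i = -1) ∧ ∀ i, v' i = ε i * v (σ i) + 2 * (u i : ℚ)

/-- The representative `(1/2, …, 1/2)`. -/
def repHalf (n : ℕ) : Fin n → ℚ := fun _ => 1 / 2

/-- The representative `(1, …, 1, 0, …, 0)` with `p` ones followed by `n − p` zeros. -/
def repOnes (n p : ℕ) : Fin n → ℚ := fun i => if (i : ℕ) < p then 1 else 0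

theorem weylEquiv_symm' {n : ℕ} {v w : Fin n → ℚ} (h : weylEquiv n v w) : weylEquiv n w v := by
  obtain ⟨σ, ε, u, hε, h⟩ := h
  have : ∀ j, ∃ k : ℤ, v j = ε (σ.symm j) * w (σ.symm j) + 2 * (k : ℚ) := by
    intro j
    have h1 := h (σ.symm j)
    rw [Equiv.apply_symm_apply] at h1
    rcases hε (σ.symm j) with h2 | h2
    · refine ⟨-u (σ.symm j), ?_⟩
      rw [h2] at h1 ⊢; push_cast; linarith
    · refine ⟨u (σ.symm j), ?_⟩
      rw [h2] at h1 ⊢; linarith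
  choose k hk using this
  exact ⟨σ.symm, fun j => ε (σ.symm j), k, fun j => hε _, hk⟩

theorem weylEquiv_trans' {n : ℕ} {v w x : Fin n → ℚ} (h : weylEquiv n v w)
    (h' : weylEquiv n w x) : weylEquiv n v x := by
  obtain ⟨σ, ε, u, hε, h⟩ := h
  obtain ⟨τ, δ, t, hδ, h'⟩ := h'
  have : ∀ j, ∃ k : ℤ, x j = (δ j * ε (τ j)) * v (σ (τ j)) + 2 * (k : ℚ) := by
    intro j
    rw [h' j, h (τ j)]
    rcases hδ j with h2 | h2
    · refine ⟨t j + u (τ j), ?_⟩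
      rw [h2]; push_cast; ring
    · refine ⟨t j - u (τ j), ?_⟩
      rw [h2]; push_cast; ring
  choose k hk using this
  refine ⟨τ.trans σ, fun j => δ j * ε (τ j), k, fun j => ?_, hk⟩
  rcases hδ j with h2 | h2 <;> rcases hε (τ j) with h3 | h3 <;> simp [h2, h3]

theorem half_not_ones {n : ℕ} (hn : 1 ≤ n) (p : ℕ) :
    ¬ weylEquiv n (repHalf n) (repOnes n p) := by
  rintro ⟨σ, ε, u, hε, h⟩
  have h0 := h ⟨0, hn⟩
  have h1 := hε ⟨0, hn⟩
  generalize u ⟨0, hn⟩ = k at h0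
  generalize ε ⟨0, hn⟩ = e at h0 h1
  simp only [repHalf, repOnes] at h0
  rcases h1 with rfl | rfl <;> split_ifs at h0
  · have : (2 : ℚ) = ((1 + 4 * k : ℤ) : ℚ) := by push_cast; linarith
    have : (2 : ℤ) = 1 + 4 * k := by exact_mod_cast this
    omega
  · have : (0 : ℚ) = ((1 + 4 * k : ℤ) : ℚ) := by push_cast; linarith
    have : (0 : ℤ) = 1 + 4 * k := by exact_mod_cast this
    omega
  · have : (2 : ℚ) = ((-1 + 4 * k : ℤ) : ℚ) := by push_cast; linarith
    have : (2 : ℤ) = -1 + 4 * k := by exact_mod_cast this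
    omega
  · have : (0 : ℚ) = ((-1 + 4 * k : ℤ) : ℚ) := by push_cast; linarith
    have : (0 : ℤ) = -1 + 4 * k := by exact_mod_cast this
    omega

theorem card_lt_fin {n p : ℕ} (hp : p ≤ n) : Fintype.card {i : Fin n // (i : ℕ) < p} = p := by
  have e : {i : Fin n // (i : ℕ) < p} ≃ Fin p :=
    { toFun := fun i => ⟨i.1, i.2⟩
      invFun := fun i => ⟨⟨i.1, by omega⟩, i.2⟩
      left_inv := fun i => rfl
      right_inv := fun i => rfl }
  rw [Fintype.card_congr e, Fintype.card_fin]

theorem ones_inj {n p p' : ℕ} (hp : p ≤ n) (hp' : p' ≤ n)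
    (h : weylEquiv n (repOnes n p) (repOnes n p')) : p = p' := by
  obtain ⟨σ, ε, u, hε, h⟩ := h
  have key : ∀ i : Fin n, (i : ℕ) < p' ↔ ((σ i : Fin n) : ℕ) < p := by
    intro i
    have h0 := h i
    have h1 := hε i
    generalize u i = k at h0
    generalize ε i = e at h0 h1
    simp only [repOnes] at h0
    by_cases a : (i : ℕ) < p' <;> by_cases b : ((σ i : Fin n) : ℕ) < p <;>
      simp only [a, b, if_true, if_false] at h0 ⊢
    · exfalso
      have : (1 : ℚ) = ((2 * k : ℤ) : ℚ) := by push_cast; linarith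
      have : (1 : ℤ) = 2 * k := by exact_mod_cast this
      omega
    · exfalso
      rcases h1 with rfl | rfl
      · have : (0 : ℚ) = ((1 + 2 * k : ℤ) : ℚ) := by push_cast; linarith
        have : (0 : ℤ) = 1 + 2 * k := by exact_mod_cast this
        omega
      · have : (0 : ℚ) = ((-1 + 2 * k : ℤ) : ℚ) := by push_cast; linarith
        have : (0 : ℤ) = -1 + 2 * k := by exact_mod_cast this
        omega
  have := Fintype.card_congr (σ.subtypeEquiv (p := fun i : Fin n => (i : ℕ) < p') (q := fun i : Fin n => (i : ℕ) < p) key)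
  rw [card_lt_fin hp, card_lt_fin hp'] at this
  exact this.symm

theorem exists_rep {n : ℕ} {v : Fin n → ℚ} (hv : v ∈ WOmega n) :
    ∃ r : Fin n → ℚ,
      (r = repHalf n ∨ ∃ p : ℕ, p ≤ n ∧ r = repOnes n p) ∧ weylEquiv n v r := by
  classical
  rcases hv with hv | hv
  · choose m hm using hv
    have hp : Fintype.card {i : Fin n // Odd (m i)} ≤ n := by
      simpa using Fintype.card_subtype_le (fun i : Fin n => Odd (m i))
    generalize hc : Fintype.card {i : Fin n // Odd (m i)} = p at hp
    have e : {i : Fin n // (i : ℕ) < p} ≃ {i : Fin n // Odd (m i)} :=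
      Fintype.equivOfCardEq (by rw [hc, card_lt_fin hp])
    refine ⟨repOnes n p, Or.inr ⟨p, hp, rfl⟩, ?_⟩
    have : ∀ i, ∃ k : ℤ, repOnes n p i = 1 * v (e.extendSubtype i) + 2 * (k : ℚ) := by
      intro i
      rw [hm]
      by_cases a : (i : ℕ) < p
      · obtain ⟨k, hk⟩ := e.extendSubtype_mem i a
        refine ⟨-k, ?_⟩
        simp only [repOnes, a, if_true]
        rw [hk]; push_cast; ring
      · obtain ⟨k, hk⟩ := Int.not_odd_iff_even.1 (e.extendSubtype_not_mem i a)
        refine ⟨-k, ?_⟩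
        simp only [repOnes, a, if_false]
        rw [hk]; push_cast; ring
    choose k hk using this
    exact ⟨e.extendSubtype, fun _ => 1, k, fun _ => Or.inl rfl, hk⟩
  · refine ⟨repHalf n, Or.inl rfl, ?_⟩
    have : ∀ i, ∃ (e : ℚ) (k : ℤ), (e = 1 ∨ e = -1) ∧ repHalf n i = e * v i + 2 * (k : ℚ) := by
      intro i
      obtain ⟨m, hm⟩ := hv i
      rw [hm]
      rcases Int.even_or_odd m with ⟨k, hk⟩ | ⟨k, hk⟩
      · refine ⟨1, -k, Or.inl rfl, ?_⟩
        rw [hk, repHalf]; push_cast; ring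
      · refine ⟨-1, k + 1, Or.inr rfl, ?_⟩
        rw [hk, repHalf]; push_cast; ring
    choose e k he hk using this
    exact ⟨Equiv.refl _, e, k, he, hk⟩

/-- Every `v ∈ ℤⁿ ∪ (ℤ + 1/2)ⁿ` is equivalent to exactly one of the `n + 2` vectors
`(1/2,…,1/2)` and `(1,…,1,0,…,0)` (`p` ones, `0 ≤ p ≤ n`); moreover these representatives are
pairwise inequivalent, so `ℤⁿ ∪ (ℤ + 1/2)ⁿ` has exactly `n + 2` equivalence classes. -/
theorem strong_real_forms_Sp (n : ℕ) (hn : 1 ≤ n) :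
    (∀ v ∈ WOmega n, ∃! r : Fin n → ℚ,
      (r = repHalf n ∨ ∃ p : ℕ, p ≤ n ∧ r = repOnes n p) ∧ weylEquiv n v r) ∧
    (∀ p : ℕ, p ≤ n → ¬ weylEquiv n (repHalf n) (repOnes n p)) ∧
    (∀ p p' : ℕ, p ≤ n → p' ≤ n → weylEquiv n (repOnes n p) (repOnes n p') → p = p') := by
  refine ⟨fun v hv => ?_, fun p _ => half_not_ones hn p, fun p p' hp hp' h => ones_inj hp hp' h⟩
  obtain ⟨r, hr, hvr⟩ := exists_rep hv
  refine ⟨r, ⟨hr, hvr⟩, ?_⟩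
  rintro s ⟨hs, hvs⟩
  have h := weylEquiv_trans' (weylEquiv_symm' hvr) hvs
  rcases hr with rfl | ⟨p, hp, rfl⟩ <;> rcases hs with rfl | ⟨q, hq, rfl⟩
  · rfl
  · exact absurd h (half_not_ones hn q)
  · exact absurd (weylEquiv_symm' h) (half_not_ones hn p)
  · rw [ones_inj hp hq h]
end
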